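/- Global asymptotic stability of the desired formation (main theorem): let N ≥ 4 and let σ1, σ2, σ3 assign to each agent l ∈ {4,…,N} three out-neighbors σ1(l) < σ2(l) < σ3(l) < l. Let p* : {1,…,N} → ℝ³ be a desired configuration in which every tetrahedron (pσ1(l)*, pσ2(l)*, pσ3(l)*, pl*) has nonzero signed volume and p1*, p2*, p3* are not collinear; let d21 := ‖p1* − p2*‖ and let the desired projection values ζl*, φl*, ϑl* be those computed from p*. Let p1, …, pN : [0,∞) → ℝ³ be differentiable and satisfy, for all t ≥ 0: p1' = 0; p2' = μ2·(‖p21‖ − d21)·p21/‖p21‖ with p21(0) ≠ 0; p3' = μ3·(⟨p31,p21⟩ − ζ3*)·p21 + ν3·(⟨p31, n123 × p21⟩ − φ3*)·(n123 × p21) with n123 = (p31 × p32)/‖p31 × p32‖ and p31(0) × p32(0) ≠ 0; and for l = 4,…,N, with i = σ1(l), j = σ2(l), k = σ3(l) and n_ijk = pki × pkj (or n_ijk = n123 when {i,j,k} = {1,2,3}), pl' = μl·ζ̃l·(pli − plj) + νl·φ̃l·(n_ijk × (pli − plj)) + λl·ϑ̃l·n_ijk, where ζ̃l = ⟨pli,pji⟩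 − ζl*, φ̃l = ⟨pli, n_ijk × pji⟩ − φl*, ϑ̃l = ⟨pli, n_ijk⟩ − ϑl*, and all gains μl, νl, λl are positive. Then the stacked error vector Λ̃(t) = (ζ̃2, ζ̃3, φ̃3, ζ̃4, φ̃4, ϑ̃4, …, ζ̃N, φ̃N, ϑ̃N)(t) converges to 0 as t → ∞; consequently the framework p(t) converges to the set of configurations strongly congruent to p* (i.e., to the images of p* under direct isometries of ℝ³). -/

import Mathlib

open scoped RealInnerProductSpace
open Real Filter

noncomputable section

/-- Euclidean 3-space. -/
abbrev E3 : Type := EuclideanSpace ℝ (Fin 3)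

/-- The cross product on `ℝ³`. -/
def cross3 (a b : E3) : E3 :=
  (WithLp.equiv 2 (Fin 3 → ℝ)).symm
    ![a 1 * b 2 - a 2 * b 1, a 2 * b 0 - a 0 * b 2, a 0 * b 1 - a 1 * b 0]

/-- The signed volume of the tetrahedron spanned by four points of `ℝ³`. -/
def signedVol (p1 p2 p3 p4 : E3) : ℝ :=
  -(1/6) * ⟪p1 - p4, cross3 (p2 - p4) (p3 - p4)⟫

/-- The affine map `x ↦ R·x + d` on `ℝ³`. -/
def rigid (R : Matrix (Fin 3) (Fin 3) ℝ) (d : E3) (x : E3) : E3 :=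
  (WithLp.equiv 2 (Fin 3 → ℝ)).symm (R.mulVec ((WithLp.equiv 2 (Fin 3 → ℝ)) x)) + d

/-! ### Setup for the closed-loop multi-agent formation system

Agents are labeled `1, …, N`.  Agent 1 is the leader, agent 2 the first follower,
agent 3 the secondary follower, and each agent `l ∈ {4, …, N}` is an ordinary follower
with out-neighbors `σ1 l < σ2 l < σ3 l < l`. -/

/-- The (time-varying) unit normal `n123 = (p31 × p32)/‖p31 × p32‖`. -/
def n123t (p : ℕ → ℝ → E3) (t : ℝ) : E3 :=
  ‖cross3 (p 1 t - p 3 t) (p 2 t - p 3 t)‖⁻¹ • cross3 (p 1 t - p 3 t) (p 2 t - p 3 t)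

/-- The (time-varying) normal `n_ijk` used by ordinary follower `l`:
`n_ijk = pki × pkj`, except that `n_ijk = n123` when `{i,j,k} = {1,2,3}`. -/
def nijk (σ1 σ2 σ3 : ℕ → ℕ) (p : ℕ → ℝ → E3) (l : ℕ) (t : ℝ) : E3 :=
  if σ1 l = 1 ∧ σ2 l = 2 ∧ σ3 l = 3 then n123t p t
  else cross3 (p (σ1 l) t - p (σ3 l) t) (p (σ2 l) t - p (σ3 l) t)

/-- The unit normal `n123` of a static configuration `q`. -/
def n123s (q : ℕ → E3) : E3 :=
  ‖cross3 (q 1 - q 3) (q 2 - q 3)‖⁻¹ • cross3 (q 1 - q 3) (q 2 - q 3)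

/-- The normal `n_ijk` of a static configuration `q`. -/
def nijks (σ1 σ2 σ3 : ℕ → ℕ) (q : ℕ → E3) (l : ℕ) : E3 :=
  if σ1 l = 1 ∧ σ2 l = 2 ∧ σ3 l = 3 then n123s q
  else cross3 (q (σ1 l) - q (σ3 l)) (q (σ2 l) - q (σ3 l))

/-- Error `ζ̃2 = ‖p21‖ − d21`, where `d21` is computed from the desired config `q`. -/
def zeta2Til (q : ℕ → E3) (p : ℕ → ℝ → E3) (t : ℝ) : ℝ :=
  ‖p 1 t - p 2 t‖ - ‖q 1 - q 2‖

/-- Error `ζ̃3 = ⟨p31, p21⟩ − ζ3*`. -/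
def zeta3Til (q : ℕ → E3) (p : ℕ → ℝ → E3) (t : ℝ) : ℝ :=
  ⟪p 1 t - p 3 t, p 1 t - p 2 t⟫ - ⟪q 1 - q 3, q 1 - q 2⟫

/-- Error `φ̃3 = ⟨p31, n123 × p21⟩ − φ3*`. -/
def phi3Til (q : ℕ → E3) (p : ℕ → ℝ → E3) (t : ℝ) : ℝ :=
  ⟪p 1 t - p 3 t, cross3 (n123t p t) (p 1 t - p 2 t)⟫ -
    ⟪q 1 - q 3, cross3 (n123s q) (q 1 - q 2)⟫

/-- Error `ζ̃l = ⟨pli, pji⟩ − ζl*` for an ordinary follower `l`. -/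
def zetaTil (σ1 σ2 σ3 : ℕ → ℕ) (q : ℕ → E3) (p : ℕ → ℝ → E3) (l : ℕ) (t : ℝ) : ℝ :=
  ⟪p (σ1 l) t - p l t, p (σ1 l) t - p (σ2 l) t⟫ -
    ⟪q (σ1 l) - q l, q (σ1 l) - q (σ2 l)⟫

/-- Error `φ̃l = ⟨pli, n_ijk × pji⟩ − φl*` for an ordinary follower `l`. -/
def phiTil (σ1 σ2 σ3 : ℕ → ℕ) (q : ℕ → E3) (p : ℕ → ℝ → E3) (l : ℕ) (t : ℝ) : ℝ :=
  ⟪p (σ1 l) t - p l t, cross3 (nijk σ1 σ2 σ3 p l t) (p (σ1 l) t - p (σ2 l) t)⟫ -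
    ⟪q (σ1 l) - q l, cross3 (nijks σ1 σ2 σ3 q l) (q (σ1 l) - q (σ2 l))⟫

/-- Error `ϑ̃l = ⟨pli, n_ijk⟩ − ϑl*` for an ordinary follower `l`. -/
def thetaTil (σ1 σ2 σ3 : ℕ → ℕ) (q : ℕ → E3) (p : ℕ → ℝ → E3) (l : ℕ) (t : ℝ) : ℝ :=
  ⟪p (σ1 l) t - p l t, nijk σ1 σ2 σ3 p l t⟫ -
    ⟪q (σ1 l) - q l, nijks σ1 σ2 σ3 q l⟫

/-- The closed-loop multi-agent system: single-integrator dynamics under the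
orthogonal-basis formation control law, with nondegenerate initial conditions. -/
def ClosedLoop (N : ℕ) (σ1 σ2 σ3 : ℕ → ℕ) (q : ℕ → E3) (μ ν lam : ℕ → ℝ)
    (p : ℕ → ℝ → E3) : Prop :=
  (∀ t : ℝ, 0 ≤ t → HasDerivAt (p 1) 0 t) ∧
  p 1 0 - p 2 0 ≠ 0 ∧
  (∀ t : ℝ, 0 ≤ t → HasDerivAt (p 2)
    ((μ 2 * zeta2Til q p t / ‖p 1 t - p 2 t‖) • (p 1 t - p 2 t)) t) ∧
  cross3 (p 1 0 - p 3 0) (p 2 0 - p 3 0) ≠ 0 ∧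
  (∀ t : ℝ, 0 ≤ t → HasDerivAt (p 3)
    ((μ 3 * zeta3Til q p t) • (p 1 t - p 2 t) +
      (ν 3 * phi3Til q p t) • cross3 (n123t p t) (p 1 t - p 2 t)) t) ∧
  (∀ l : ℕ, 4 ≤ l → l ≤ N → ∀ t : ℝ, 0 ≤ t → HasDerivAt (p l)
    ((μ l * zetaTil σ1 σ2 σ3 q p l t) • (p (σ1 l) t - p (σ2 l) t) +
      (ν l * phiTil σ1 σ2 σ3 q p l t) •
        cross3 (nijk σ1 σ2 σ3 p l t) (p (σ1 l) t - p (σ2 l) t) +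
      (lam l * thetaTil σ1 σ2 σ3 q p l t) • nijk σ1 σ2 σ3 p l t) t)

/-- The set of configurations of `N` agents strongly congruent to the desired
configuration `q` (images of `q` under a direct isometry of `ℝ³`). -/
def SCgt (N : ℕ) (q : ℕ → E3) : Set (Fin N → E3) :=
  {c | ∃ R : Matrix (Fin 3) (Fin 3) ℝ, ∃ d : E3,
    R ∈ Matrix.orthogonalGroup (Fin 3) ℝ ∧ R.det = 1 ∧
    ∀ i : Fin N, c i = rigid R d (q (i.1 + 1))}

open Topology

/-! ### Decay of solutions of dissipative equations -/

lemma tendsto_zero_of_deriv_le {V V' c : ℝ → ℝ} {a : ℝ} (ha : 0 < a) (hV : ∀ t, 0 ≤ V t)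
    (hd : ∀ᶠ t in atTop, HasDerivAt V (V' t) t)
    (hle : ∀ᶠ t in atTop, V' t ≤ -a * V t + c t) (hc : Tendsto c atTop (𝓝 0)) :
    Tendsto V atTop (𝓝 0) := by
  rw [Metric.tendsto_atTop]
  intro ε hε
  obtain ⟨T, hT⟩ := eventually_atTop.1
    (hd.and (hle.and (hc.eventually (ge_mem_nhds (show (0 : ℝ) < a * (ε / 2) by positivity)))))
  have hder : ∀ t, T ≤ t → HasDerivAt (fun s => (V s - ε / 2) * exp (a * s))
      (V' t * exp (a * t) + (V t - ε / 2) * (exp (a * t) * a)) t := fun t ht =>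
    ((hT t ht).1.sub_const _).mul (by simpa using ((hasDerivAt_id t).const_mul a).exp)
  have hanti : AntitoneOn (fun s => (V s - ε / 2) * exp (a * s)) (Set.Ici T) := by
    refine antitoneOn_of_hasDerivWithinAt_nonpos (convex_Ici T)
      (fun t ht => (hder t ht).continuousAt.continuousWithinAt)
      (fun t ht => (hder t (interior_subset ht)).hasDerivWithinAt) fun t ht => ?_
    obtain ⟨-, h1, h2⟩ := hT t (interior_subset ht)
    have : V' t + (V t - ε / 2) * a ≤ 0 := by linarith
    nlinarith [exp_pos (a * t)]
  have hexp : Tendsto (fun t => (V T - ε / 2) * exp (a * T) * exp (-(a * t))) atTop (𝓝 0) := by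
    simpa using (tendsto_exp_neg_atTop_nhds_zero.comp
      (tendsto_id.const_mul_atTop ha)).const_mul ((V T - ε / 2) * exp (a * T))
  obtain ⟨S, hS⟩ := eventually_atTop.1
    (hexp.eventually (gt_mem_nhds (show (0 : ℝ) < ε / 2 by positivity)))
  refine ⟨max S T, fun t ht => ?_⟩
  have h1 := hanti Set.self_mem_Ici (le_trans (le_max_right S T) ht) (le_trans (le_max_right S T) ht)
  have h2 := hS t (le_trans (le_max_left S T) ht)
  have h3 : V t - ε / 2 ≤ (V T - ε / 2) * exp (a * T) * exp (-(a * t)) := by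
    rw [exp_neg, ← div_eq_mul_inv, le_div_iff₀ (exp_pos _)]
    exact h1
  rw [Real.dist_eq, sub_zero, abs_of_nonneg (hV t)]
  linarith

lemma tendsto_zero_of_inner_le {E : Type*} [NormedAddCommGroup E] [InnerProductSpace ℝ E]
    {z z' : ℝ → E} {c : ℝ → ℝ} {a : ℝ} (ha : 0 < a)
    (hd : ∀ᶠ t in atTop, HasDerivAt z (z' t) t)
    (hle : ∀ᶠ t in atTop, ⟪z t, z' t⟫ ≤ -a * ‖z t‖ ^ 2 + ‖z t‖ * c t)
    (hc : Tendsto c atTop (𝓝 0)) : Tendsto z atTop (𝓝 0) := by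
  have hsq : Tendsto (fun t => ‖z t‖ ^ 2) atTop (𝓝 0) := by
    refine tendsto_zero_of_deriv_le (V' := fun t => 2 * ⟪z t, z' t⟫)
      (c := fun t => c t ^ 2 / a) ha (fun t => by positivity) ?_ ?_ ?_
    · filter_upwards [hd] with t ht using ht.norm_sq
    · filter_upwards [hle] with t ht
      have h : 2 * (‖z t‖ * c t) ≤ a * ‖z t‖ ^ 2 + c t ^ 2 / a := by
        have : a * ‖z t‖ ^ 2 + c t ^ 2 / a - 2 * (‖z t‖ * c t)
            = (a * ‖z t‖ - c t) ^ 2 / a := by field_simp; ring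
        have h0 : 0 ≤ (a * ‖z t‖ - c t) ^ 2 / a := by positivity
        linarith
      linarith
    · simpa using (hc.pow 2).div_const a
  rw [tendsto_zero_iff_norm_tendsto_zero]
  simpa [Real.sqrt_sq] using hsq.sqrt

/-- Solutions of the scalar equation `u' = -α (u - β)` follow the limit of `β`. -/
lemma tendsto_of_linear_tracking {u α β : ℝ → ℝ} {a A b : ℝ} (ha : 0 < a)
    (hα : ∀ t, 0 ≤ t → a ≤ α t) (hA : ∀ t, 0 ≤ t → α t ≤ A) (hβ : Tendsto β atTop (𝓝 b))
    (hd : ∀ t, 0 ≤ t → HasDerivAt u (-(α t * (u t - β t))) t) : Tendsto u atTop (𝓝 b) := by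
  suffices Tendsto (fun t => u t - b) atTop (𝓝 0) by simpa using this.add_const b
  refine tendsto_zero_of_inner_le (z' := fun t => -(α t * (u t - β t)))
    (c := fun t => A * |β t - b|) ha ?_ ?_ ?_
  · filter_upwards [eventually_ge_atTop 0] with t ht using (hd t ht).sub_const b
  · filter_upwards [eventually_ge_atTop 0] with t ht
    rw [real_inner_eq_re_inner, RCLike.inner_apply]
    simp only [conj_trivial, RCLike.re_to_real, Real.norm_eq_abs, sq_abs]
    have h1 : α t * ((u t - b) * (β t - b)) ≤ |u t - b| * (A * |β t - b|) := by
      calc α t * ((u t - b) * (β t - b)) ≤ α t * |(u t - b) * (β t - b)| :=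
            mul_le_mul_of_nonneg_left (le_abs_self _) (ha.le.trans (hα t ht))
        _ ≤ A * |(u t - b) * (β t - b)| :=
            mul_le_mul_of_nonneg_right (hA t ht) (abs_nonneg _)
        _ = |u t - b| * (A * |β t - b|) := by rw [abs_mul]; ring
    have h2 := mul_le_mul_of_nonneg_right (hα t ht) (sq_nonneg (u t - b))
    nlinarith
  · simpa using ((hβ.sub_const b).abs).const_mul A

/-- A vector pulled radially towards length `β` keeps its direction, never vanishes, and its
length follows the limit of `β`. -/
lemma radial_tracking {E : Type*} [NormedAddCommGroup E] [InnerProductSpace ℝ E]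
    {v : ℝ → E} {α β : ℝ → ℝ} {a A b : ℝ} (ha : 0 < a)
    (hα : ∀ t, 0 ≤ t → a ≤ α t) (hA : ∀ t, 0 ≤ t → α t ≤ A) (hβ0 : ∀ t, 0 ≤ t → 0 ≤ β t)
    (hβ : Tendsto β atTop (𝓝 b)) (hv0 : v 0 ≠ 0)
    (hd : ∀ t, 0 ≤ t → HasDerivAt v (-(α t * (‖v t‖ - β t) * ‖v t‖⁻¹) • v t) t) :
    (∃ e : E, ‖e‖ = 1 ∧ ∀ t, 0 ≤ t → 0 < ‖v t‖ ∧ v t = ‖v t‖ • e) ∧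
      Tendsto (fun t => ‖v t‖) atTop (𝓝 b) := by
  have hpos : ∀ t, 0 ≤ t → 0 < ‖v t‖ := by
    have hder : ∀ t, 0 ≤ t → HasDerivAt (fun s => ‖v s‖ ^ 2 * exp (2 * A * s))
        (2 * ⟪v t, -(α t * (‖v t‖ - β t) * ‖v t‖⁻¹) • v t⟫ * exp (2 * A * t)
          + ‖v t‖ ^ 2 * (exp (2 * A * t) * (2 * A))) t := fun t ht =>
      (hd t ht).norm_sq.mul (by simpa using ((hasDerivAt_id t).const_mul (2 * A)).exp)
    have hmono : MonotoneOn (fun s => ‖v s‖ ^ 2 * exp (2 * A * s)) (Set.Ici 0) := by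
      refine monotoneOn_of_hasDerivWithinAt_nonneg (convex_Ici 0)
        (fun t ht => (hder t ht).continuousAt.continuousWithinAt)
        (fun t ht => (hder t (interior_subset ht)).hasDerivWithinAt) fun t ht => ?_
      replace ht : 0 ≤ t := interior_subset ht
      have h1 : ⟪v t, -(α t * (‖v t‖ - β t) * ‖v t‖⁻¹) • v t⟫
          = -(α t * (‖v t‖ - β t) * ‖v t‖) := by
        rw [inner_smul_right, real_inner_self_eq_norm_sq]
        by_cases h : ‖v t‖ = 0
        · simp [h]
        · field_simp
      have h2 : 0 ≤ -(α t * (‖v t‖ - β t) * ‖v t‖) + A * ‖v t‖ ^ 2 := by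
        have h3 := mul_le_mul_of_nonneg_right (hA t ht) (sq_nonneg ‖v t‖)
        have h4 : 0 ≤ α t * β t * ‖v t‖ :=
          mul_nonneg (mul_nonneg (ha.le.trans (hα t ht)) (hβ0 t ht)) (norm_nonneg _)
        nlinarith
      rw [h1]
      nlinarith [exp_pos (2 * A * t)]
    intro t ht
    have h := hmono Set.self_mem_Ici ht ht
    simp only [mul_zero, exp_zero, mul_one] at h
    have h0 : 0 < ‖v 0‖ ^ 2 := by positivity
    rcases (norm_nonneg (v t)).eq_or_lt with h1 | h1
    · simp only [← h1, ne_eq, OfNat.ofNat_ne_zero, not_false_eq_true, zero_pow, zero_mul] at h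
      linarith
    · exact h1
  have hnorm : ∀ t, 0 ≤ t → HasDerivAt (fun s => ‖v s‖) (-(α t * (‖v t‖ - β t))) t := by
    intro t ht
    have h := (hd t ht).norm_sq.sqrt (by have := hpos t ht; positivity)
    simp only [Real.sqrt_sq (norm_nonneg _)] at h
    convert h using 1
    rw [inner_smul_right, real_inner_self_eq_norm_sq]
    have := (hpos t ht).ne'
    field_simp
  refine ⟨⟨‖v 0‖⁻¹ • v 0, ?_, fun t ht => ⟨hpos t ht, ?_⟩⟩,
    tendsto_of_linear_tracking ha hα hA hβ hnorm⟩
  · rw [norm_smul, norm_inv, norm_norm, inv_mul_cancel₀ (norm_ne_zero_iff.2 hv0)]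
  · have hdir : ∀ t, 0 ≤ t → HasDerivAt (fun s => ‖v s‖⁻¹ • v s) 0 t := by
      intro t ht
      convert! ((hnorm t ht).fun_inv (hpos t ht).ne').fun_smul (hd t ht) using 1
      rw [smul_smul, ← add_smul]
      convert (zero_smul ℝ (v t)).symm using 2
      have := (hpos t ht).ne'
      field_simp
      ring
    have hconst := constant_of_has_deriv_right_zero (a := 0) (b := t)
      (f := fun s => ‖v s‖⁻¹ • v s)
      (fun s hs => (hdir s hs.1).continuousAt.continuousWithinAt)
      (fun s hs => (hdir s hs.1).hasDerivWithinAt) t ⟨ht, le_rfl⟩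
    rw [← hconst, smul_smul, mul_inv_cancel₀ (hpos t ht).ne', one_smul]

/-! ### The cross product -/

@[simp] lemma cross3_apply_zero (a b : E3) : cross3 a b 0 = a 1 * b 2 - a 2 * b 1 := rfl

@[simp] lemma cross3_apply_one (a b : E3) : cross3 a b 1 = a 2 * b 0 - a 0 * b 2 := rfl

@[simp] lemma cross3_apply_two (a b : E3) : cross3 a b 2 = a 0 * b 1 - a 1 * b 0 := rfl

lemma inner_E3 (a b : E3) : ⟪a, b⟫ = a 0 * b 0 + a 1 * b 1 + a 2 * b 2 := by
  simp [PiLp.inner_apply, Fin.sum_univ_three, mul_comm]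

lemma norm_sq_E3 (a : E3) : ‖a‖ ^ 2 = a 0 ^ 2 + a 1 ^ 2 + a 2 ^ 2 := by
  rw [← real_inner_self_eq_norm_sq, inner_E3]
  ring

lemma E3_ext {a b : E3} (h0 : a 0 = b 0) (h1 : a 1 = b 1) (h2 : a 2 = b 2) : a = b := by
  ext i
  fin_cases i <;> assumption

lemma cross3_smul_right (c : ℝ) (a b : E3) : cross3 a (c • b) = c • cross3 a b := by
  apply E3_ext <;> simp <;> ring

lemma cross3_smul_left (c : ℝ) (a b : E3) : cross3 (c • a) b = c • cross3 a b := by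
  apply E3_ext <;> simp <;> ring

lemma cross3_add_right (a b c : E3) : cross3 a (b + c) = cross3 a b + cross3 a c := by
  apply E3_ext <;> simp <;> ring

lemma cross3_self (a : E3) : cross3 a a = 0 := by
  apply E3_ext <;> simp <;> ring

lemma cross3_zero_right (a : E3) : cross3 a 0 = 0 := by
  apply E3_ext <;> simp

/-- The vectors `p31 × p32` and `p21 × p31` agree. -/
lemma cross3_sub_sub (a b c : E3) : cross3 (a - c) (b - c) = cross3 (a - b) (a - c) := by
  apply E3_ext <;> simp <;> ring

lemma inner_cross3_comm (a b c : E3) : ⟪a, cross3 b c⟫ = ⟪b, cross3 c a⟫ := by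
  simp only [inner_E3, cross3_apply_zero, cross3_apply_one, cross3_apply_two]
  ring

lemma inner_cross3_self_left (a b : E3) : ⟪a, cross3 a b⟫ = 0 := by
  simp only [inner_E3, cross3_apply_zero, cross3_apply_one, cross3_apply_two]
  ring

lemma cross3_cross3 (a b c : E3) : cross3 a (cross3 b c) = ⟪a, c⟫ • b - ⟪a, b⟫ • c := by
  apply E3_ext <;> simp [inner_E3] <;> ring

lemma cross3_anticomm (a b : E3) : cross3 a b = -cross3 b a := by
  apply E3_ext <;> simp <;> ring

/-- A vector is determined by its component along a unit vector and their cross product. -/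
lemma eq_inner_smul_add_cross3 {e : E3} (he : ‖e‖ = 1) (x : E3) :
    x = ⟪e, x⟫ • e + cross3 (cross3 e x) e := by
  rw [cross3_anticomm, cross3_cross3, real_inner_self_eq_norm_sq, he]
  simp

lemma continuous_cross3 : Continuous fun x : E3 × E3 => cross3 x.1 x.2 := by
  unfold cross3
  refine (PiLp.continuous_toLp 2 _).comp (continuous_pi fun i => ?_)
  fin_cases i <;> simp <;> fun_prop

lemma tendsto_cross3 {ι : Type*} {l : Filter ι} {f g : ι → E3} {a b : E3}
    (hf : Tendsto f l (𝓝 a)) (hg : Tendsto g l (𝓝 b)) :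
    Tendsto (fun t => cross3 (f t) (g t)) l (𝓝 (cross3 a b)) :=
  Tendsto.comp (g := fun x : E3 × E3 => cross3 x.1 x.2) (f := fun t => (f t, g t))
    (y := 𝓝 (a, b)) continuous_cross3.continuousAt (hf.prodMk_nhds hg)

lemma hasDerivAt_cross3_const {x : ℝ → E3} {x' : E3} {t : ℝ} (e : E3) (hx : HasDerivAt x x' t) :
    HasDerivAt (fun s => cross3 e (x s)) (cross3 e x') t := by
  let L : E3 →ₗ[ℝ] E3 :=
    { toFun := cross3 e
      map_add' := cross3_add_right e
      map_smul' := fun c b => cross3_smul_right c e b }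
  exact ((LinearMap.toContinuousLinearMap L).hasFDerivAt (x := x t)).comp_hasDerivAt t hx

/-- Parseval's identity in the orthogonal basis `y`, `m`, `m × y`. -/
lemma norm_sq_mul_of_orthogonal {y m : E3} (h : ⟪y, m⟫ = 0) (z : E3) :
    ‖y‖ ^ 2 * ‖m‖ ^ 2 * ‖z‖ ^ 2
      = ‖m‖ ^ 2 * ⟪z, y⟫ ^ 2 + ⟪z, cross3 m y⟫ ^ 2 + ‖y‖ ^ 2 * ⟪z, m⟫ ^ 2 := by
  have key : ‖y‖ ^ 2 * ‖m‖ ^ 2 * ‖z‖ ^ 2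
      = ‖m‖ ^ 2 * ⟪z, y⟫ ^ 2 + ⟪z, cross3 m y⟫ ^ 2 + ‖y‖ ^ 2 * ⟪z, m⟫ ^ 2
        + ⟪y, m⟫ * (⟪y, m⟫ * ‖z‖ ^ 2 - 2 * ⟪z, y⟫ * ⟪z, m⟫) := by
    simp only [norm_sq_E3, inner_E3, cross3_apply_zero, cross3_apply_one, cross3_apply_two]
    ring
  rw [key, h]
  ring

/-! ### Rotations -/

/-- The linear action of a matrix on `E3`. -/
def act (R : Matrix (Fin 3) (Fin 3) ℝ) : E3 →ₗ[ℝ] E3 := Matrix.toEuclideanLin R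

lemma act_apply (R : Matrix (Fin 3) (Fin 3) ℝ) (x : E3) (i : Fin 3) :
    act R x i = R i 0 * x 0 + R i 1 * x 1 + R i 2 * x 2 := by
  simp [act, Matrix.toLpLin_apply, Matrix.mulVec, dotProduct, Fin.sum_univ_three]

lemma rigid_eq (R : Matrix (Fin 3) (Fin 3) ℝ) (d x : E3) : rigid R d x = act R x + d := rfl

lemma rigid_sub (R : Matrix (Fin 3) (Fin 3) ℝ) (d x y : E3) :
    rigid R d x - rigid R d y = act R (x - y) := by
  rw [rigid_eq, rigid_eq, map_sub]
  abel

section Rotation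

variable {R : Matrix (Fin 3) (Fin 3) ℝ}

lemma inner_act (hR : R ∈ Matrix.orthogonalGroup (Fin 3) ℝ) (x y : E3) :
    ⟪act R x, act R y⟫ = ⟪x, y⟫ := by
  have h := (Matrix.mem_orthogonalGroup_iff' (Fin 3) ℝ).1 hR
  have hc : ∀ i j, R 0 i * R 0 j + R 1 i * R 1 j + R 2 i * R 2 j
      = (1 : Matrix (Fin 3) (Fin 3) ℝ) i j := by
    intro i j
    rw [← h]
    simp [Matrix.mul_apply, Fin.sum_univ_three]
  have h00 := hc 0 0
  have h01 := hc 0 1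
  have h02 := hc 0 2
  have h11 := hc 1 1
  have h12 := hc 1 2
  have h22 := hc 2 2
  simp only [Matrix.one_apply, Fin.isValue, if_true, zero_ne_one, if_false, Fin.reduceEq]
    at h00 h01 h02 h11 h12 h22
  simp only [inner_E3, act_apply]
  linear_combination x 0 * y 0 * h00 + (x 0 * y 1 + x 1 * y 0) * h01
    + (x 0 * y 2 + x 2 * y 0) * h02 + x 1 * y 1 * h11 + (x 1 * y 2 + x 2 * y 1) * h12
    + x 2 * y 2 * h22

lemma norm_act (hR : R ∈ Matrix.orthogonalGroup (Fin 3) ℝ) (x : E3) : ‖act R x‖ = ‖x‖ := by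
  rw [norm_eq_sqrt_real_inner, inner_act hR, ← norm_eq_sqrt_real_inner]

lemma cross3_act (hR : R ∈ Matrix.orthogonalGroup (Fin 3) ℝ) (hdet : R.det = 1) (x y : E3) :
    cross3 (act R x) (act R y) = act R (cross3 x y) := by
  have hadj : R.adjugate = R.transpose := by
    calc R.adjugate = R.adjugate * (R * R.transpose) := by
          rw [(Matrix.mem_orthogonalGroup_iff (Fin 3) ℝ).1 hR, mul_one]
      _ = R.transpose := by rw [← mul_assoc, Matrix.adjugate_mul, hdet, one_smul, one_mul]
  have hc : ∀ i j, R i j = R.adjugate j i := by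
    intro i j
    rw [hadj, Matrix.transpose_apply]
  apply E3_ext <;>
    simp only [cross3_apply_zero, cross3_apply_one, cross3_apply_two, act_apply]
  · rw [hc 0 0, hc 0 1, hc 0 2]
    simp [Matrix.adjugate_fin_three]
    ring
  · rw [hc 1 0, hc 1 1, hc 1 2]
    simp [Matrix.adjugate_fin_three]
    ring
  · rw [hc 2 0, hc 2 1, hc 2 2]
    simp [Matrix.adjugate_fin_three]
    ring

end Rotation

/-- The matrix with rows `e`, `n`, `e × n`. -/
def frame (e n : E3) : Matrix (Fin 3) (Fin 3) ℝ := Matrix.of ![⇑e, ⇑n, ⇑(cross3 e n)]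

lemma frame_mul_transpose {e n : E3} (he : ‖e‖ = 1) (hn : ‖n‖ = 1) (hen : ⟪e, n⟫ = 0) :
    frame e n * (frame e n).transpose = 1 := by
  have h1 := norm_sq_E3 e
  have h2 := norm_sq_E3 n
  rw [he] at h1
  rw [hn] at h2
  rw [inner_E3] at hen
  ext i j
  fin_cases i <;> fin_cases j <;> simp [frame, Matrix.mul_apply, Fin.sum_univ_three]
  · linear_combination -h1
  · linear_combination hen
  · ring
  · linear_combination hen
  · linear_combination -h2
  · ring
  · ring
  · ring
  · linear_combination -(n 0 ^ 2 + n 1 ^ 2 + n 2 ^ 2) * h1 - h2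
      - (e 0 * n 0 + e 1 * n 1 + e 2 * n 2) * hen

lemma det_frame {e n : E3} (he : ‖e‖ = 1) (hn : ‖n‖ = 1) (hen : ⟪e, n⟫ = 0) :
    (frame e n).det = 1 := by
  have h1 := norm_sq_E3 e
  have h2 := norm_sq_E3 n
  rw [he] at h1
  rw [hn] at h2
  rw [inner_E3] at hen
  rw [Matrix.det_fin_three]
  simp [frame]
  linear_combination -(n 0 ^ 2 + n 1 ^ 2 + n 2 ^ 2) * h1 - h2
    - (e 0 * n 0 + e 1 * n 1 + e 2 * n 2) * hen

/-- Rotations act transitively on orthonormal pairs. -/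
lemma exists_rotation {e n e' n' : E3} (he : ‖e‖ = 1) (hn : ‖n‖ = 1) (hen : ⟪e, n⟫ = 0)
    (he' : ‖e'‖ = 1) (hn' : ‖n'‖ = 1) (hen' : ⟪e', n'⟫ = 0) :
    ∃ R ∈ Matrix.orthogonalGroup (Fin 3) ℝ, R.det = 1 ∧ act R e = e' ∧ act R n = n' := by
  have hF := frame_mul_transpose he hn hen
  have hF' := frame_mul_transpose he' hn' hen'
  have hF'' := mul_eq_one_comm.1 hF'
  refine ⟨(frame e' n').transpose * frame e n, ?_, ?_, ?_, ?_⟩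
  · rw [Matrix.mem_orthogonalGroup_iff, Matrix.transpose_mul,
      Matrix.transpose_transpose, mul_assoc, ← mul_assoc (frame e n), hF, one_mul, hF'']
  · rw [Matrix.det_mul, Matrix.det_transpose, det_frame he hn hen, det_frame he' hn' hen', one_mul]
  · have h0 : (frame e n).mulVec ⇑e = ![1, 0, 0] := by
      have h1 := norm_sq_E3 e
      rw [he] at h1
      rw [inner_E3] at hen
      ext i
      fin_cases i <;> simp [frame, Matrix.mulVec, dotProduct, Fin.sum_univ_three]
      · linear_combination -h1
      · linear_combination hen
      · ring
    ext i
    change (((frame e' n').transpose * frame e n).mulVec ⇑e) i = _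
    rw [← Matrix.mulVec_mulVec, h0]
    simp [frame, Matrix.mulVec, dotProduct, Fin.sum_univ_three]
  · have h0 : (frame e n).mulVec ⇑n = ![0, 1, 0] := by
      have h1 := norm_sq_E3 n
      rw [hn] at h1
      rw [inner_E3] at hen
      ext i
      fin_cases i <;> simp [frame, Matrix.mulVec, dotProduct, Fin.sum_univ_three]
      · linear_combination hen
      · linear_combination -h1
      · ring
    ext i
    change (((frame e' n').transpose * frame e n).mulVec ⇑n) i = _
    rw [← Matrix.mulVec_mulVec, h0]
    simp [frame, Matrix.mulVec, dotProduct, Fin.sum_univ_three]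

/-! ### Ordinary followers -/

/-- An agent steered along the orthogonal frame `y`, `m × y`, `m` converges to the position with
the prescribed projections as soon as the frame and the reference point converge. -/
lemma follower_tendsto {x o y m : ℝ → E3} {X O Y M : E3} {μ ν κ ζ φ θ : ℝ}
    (hμ : 0 < μ) (hν : 0 < ν) (hκ : 0 < κ)
    (ho : Tendsto o atTop (𝓝 O)) (hy : Tendsto y atTop (𝓝 Y)) (hm : Tendsto m atTop (𝓝 M))
    (hY : Y ≠ 0) (hM : M ≠ 0) (horth : ∀ t, ⟪y t, m t⟫ = 0)
    (hζ : ⟪O - X, Y⟫ = ζ) (hφ : ⟪O - X, cross3 M Y⟫ = φ) (hθ : ⟪O - X, M⟫ = θ)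
    (hx : ∀ t, 0 ≤ t → HasDerivAt x
      ((μ * (⟪o t - x t, y t⟫ - ζ)) • y t +
        (ν * (⟪o t - x t, cross3 (m t) (y t)⟫ - φ)) • cross3 (m t) (y t) +
        (κ * (⟪o t - x t, m t⟫ - θ)) • m t) t) :
    Tendsto x atTop (𝓝 X) := by
  have hc : Tendsto (fun t => cross3 (m t) (y t)) atTop (𝓝 (cross3 M Y)) := tendsto_cross3 hm hy
  set f : ℝ → E3 := fun t =>
    (μ * (⟪o t - X, y t⟫ - ζ)) • y t +
      (ν * (⟪o t - X, cross3 (m t) (y t)⟫ - φ)) • cross3 (m t) (y t) +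
      (κ * (⟪o t - X, m t⟫ - θ)) • m t with hf
  have hf0 : Tendsto f atTop (𝓝 0) := by
    have h := ((((((ho.sub_const X).inner hy).sub_const ζ).const_mul μ).smul hy).add
      (((((ho.sub_const X).inner hc).sub_const φ).const_mul ν).smul hc)).add
      (((((ho.sub_const X).inner hm).sub_const θ).const_mul κ).smul hm)
    simpa [hζ, hφ, hθ] using h
  have hY0 : 0 < ‖Y‖ ^ 2 := by positivity
  have hM0 : 0 < ‖M‖ ^ 2 := by positivity
  have hy2 := hy.norm.pow 2
  have hm2 := hm.norm.pow 2
  set C : ℝ := 2 * ‖M‖ ^ 2 / μ + 1 / ν + 2 * ‖Y‖ ^ 2 / κ with hC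
  have hC0 : 0 < C := by positivity
  suffices Tendsto (fun t => x t - X) atTop (𝓝 0) by simpa using this.add_const X
  refine tendsto_zero_of_inner_le (a := ‖Y‖ ^ 2 / 2 * (‖M‖ ^ 2 / 2) / C)
    (c := fun t => ‖f t‖) (by positivity)
    ((eventually_ge_atTop 0).mono fun t ht => (hx t ht).sub_const X) ?_ (by simpa using hf0.norm)
  filter_upwards [hy2.eventually (lt_mem_nhds (half_lt_self hY0)),
    hm2.eventually (lt_mem_nhds (half_lt_self hM0)),
    hy2.eventually (gt_mem_nhds (show ‖Y‖ ^ 2 < 2 * ‖Y‖ ^ 2 by linarith)),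
    hm2.eventually (gt_mem_nhds (show ‖M‖ ^ 2 < 2 * ‖M‖ ^ 2 by linarith))] with t h1 h2 h3 h4
  set z := x t - X with hz
  have hoz : ∀ v : E3, ⟪o t - x t, v⟫ = ⟪o t - X, v⟫ - ⟪z, v⟫ := fun v => by
    rw [← inner_sub_left, hz, sub_sub_sub_cancel_right]
  set Q := μ * ⟪z, y t⟫ ^ 2 + ν * ⟪z, cross3 (m t) (y t)⟫ ^ 2 + κ * ⟪z, m t⟫ ^ 2 with hQ
  have hsplit : ⟪z, (μ * (⟪o t - x t, y t⟫ - ζ)) • y t +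
        (ν * (⟪o t - x t, cross3 (m t) (y t)⟫ - φ)) • cross3 (m t) (y t) +
        (κ * (⟪o t - x t, m t⟫ - θ)) • m t⟫ = -Q + ⟪z, f t⟫ := by
    simp only [hf, hQ, hoz, inner_add_right, inner_smul_right]
    ring
  have hcoer : ‖Y‖ ^ 2 / 2 * (‖M‖ ^ 2 / 2) * ‖z‖ ^ 2 ≤ C * Q := by
    calc ‖Y‖ ^ 2 / 2 * (‖M‖ ^ 2 / 2) * ‖z‖ ^ 2 ≤ ‖y t‖ ^ 2 * ‖m t‖ ^ 2 * ‖z‖ ^ 2 := by gcongr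
      _ = ‖m t‖ ^ 2 * ⟪z, y t⟫ ^ 2 + ⟪z, cross3 (m t) (y t)⟫ ^ 2 + ‖y t‖ ^ 2 * ⟪z, m t⟫ ^ 2 :=
        norm_sq_mul_of_orthogonal (horth t) z
      _ ≤ 2 * ‖M‖ ^ 2 * ⟪z, y t⟫ ^ 2 + ⟪z, cross3 (m t) (y t)⟫ ^ 2
          + 2 * ‖Y‖ ^ 2 * ⟪z, m t⟫ ^ 2 := by gcongr
      _ = 2 * ‖M‖ ^ 2 / μ * (μ * ⟪z, y t⟫ ^ 2)
          + 1 / ν * (ν * ⟪z, cross3 (m t) (y t)⟫ ^ 2)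
          + 2 * ‖Y‖ ^ 2 / κ * (κ * ⟪z, m t⟫ ^ 2) := by field_simp
      _ ≤ C * (μ * ⟪z, y t⟫ ^ 2) + C * (ν * ⟪z, cross3 (m t) (y t)⟫ ^ 2)
          + C * (κ * ⟪z, m t⟫ ^ 2) := by
        have e1 : 0 < 2 * ‖M‖ ^ 2 / μ := by positivity
        have e2 : 0 < 1 / ν := by positivity
        have e3 : 0 < 2 * ‖Y‖ ^ 2 / κ := by positivity
        gcongr <;> linarith
      _ = C * Q := by rw [hQ]; ring
  rw [hsplit]
  have hdiv : ‖Y‖ ^ 2 / 2 * (‖M‖ ^ 2 / 2) / C * ‖z‖ ^ 2 ≤ Q := by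
    rw [div_mul_eq_mul_div, div_le_iff₀ hC0]
    linarith
  have hcs := real_inner_le_norm z (f t)
  linarith

/-! ### The leader and the first two followers -/

lemma exists_upper_bound_of_tendsto {f : ℝ → ℝ} {b : ℝ} (hc : ∀ t, 0 ≤ t → ContinuousAt f t)
    (hf : Tendsto f atTop (𝓝 b)) : ∃ A, ∀ t, 0 ≤ t → f t ≤ A := by
  obtain ⟨T, hT⟩ := eventually_atTop.1 (hf.eventually (gt_mem_nhds (lt_add_one b)))
  obtain ⟨B, hB⟩ := (isCompact_Icc (a := (0 : ℝ)) (b := T)).bddAbove_image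
    fun t ht => (hc t ht.1).continuousWithinAt
  refine ⟨max B (b + 1), fun t ht => ?_⟩
  rcases le_total t T with h | h
  · exact (hB ⟨t, ⟨ht, h⟩, rfl⟩).trans (le_max_left _ _)
  · exact (hT t h).le.trans (le_max_right _ _)

/-- The projection `φ3` is the area of the parallelogram spanned by `p21` and `p31`. -/
lemma inner_cross3_normal (y x : E3) :
    ⟪x, cross3 (‖cross3 y x‖⁻¹ • cross3 y x) y⟫ = ‖cross3 y x‖ := by
  rw [inner_cross3_comm, real_inner_smul_left, real_inner_self_eq_norm_sq]
  by_cases h : ‖cross3 y x‖ = 0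
  · simp [h]
  · field_simp

lemma act_leading_triangle {R : Matrix (Fin 3) (Fin 3) ℝ}
    (hR : R ∈ Matrix.orthogonalGroup (Fin 3) ℝ) (hdet : R.det = 1) {y x e n : E3}
    (hy : y ≠ 0) (hw : cross3 y x ≠ 0) (he : act R (‖y‖⁻¹ • y) = e)
    (hn : act R (‖cross3 y x‖⁻¹ • cross3 y x) = n) :
    act R x = (⟪x, y⟫ / ‖y‖) • e + (‖cross3 y x‖ / ‖y‖) • cross3 n e := by
  have h1 : ‖‖y‖⁻¹ • y‖ = 1 := by
    rw [norm_smul, norm_inv, norm_norm, inv_mul_cancel₀ (norm_ne_zero_iff.2 hy)]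
  rw [← he, ← hn, cross3_act hR hdet, ← map_smul, ← map_smul, ← map_add]
  congr 1
  conv_lhs => rw [eq_inner_smul_add_cross3 h1 x]
  have h2 : ‖cross3 y x‖ ≠ 0 := norm_ne_zero_iff.2 hw
  rw [real_inner_smul_left, real_inner_comm]
  simp only [cross3_smul_left, cross3_smul_right, smul_smul]
  congr 2
  · ring
  · field_simp

/-- The agents `1`, `2`, `3` converge to a rotated and translated copy of their desired
positions. -/
lemma leading_triangle_tendsto {N : ℕ} {σ1 σ2 σ3 : ℕ → ℕ} {q : ℕ → E3} {μ ν lam : ℕ → ℝ}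
    {p : ℕ → ℝ → E3} (hcol : cross3 (q 1 - q 3) (q 2 - q 3) ≠ 0)
    (hμ2 : 0 < μ 2) (hμ3 : 0 < μ 3) (hν3 : 0 < ν 3)
    (hcl : ClosedLoop N σ1 σ2 σ3 q μ ν lam p) :
    ∃ R ∈ Matrix.orthogonalGroup (Fin 3) ℝ, R.det = 1 ∧ ∃ d : E3,
      ∀ i, 1 ≤ i → i ≤ 3 → Tendsto (p i) atTop (𝓝 (rigid R d (q i))) := by
  obtain ⟨h1, h20, h2, h30, h3, -⟩ := hcl
  rw [cross3_sub_sub] at hcol h30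
  have hp1 : ∀ t, 0 ≤ t → p 1 t = p 1 0 := fun t ht =>
    constant_of_has_deriv_right_zero (a := 0) (b := t)
      (fun s hs => (h1 s hs.1).continuousAt.continuousWithinAt)
      (fun s hs => (h1 s hs.1).hasDerivWithinAt) t ⟨ht, le_rfl⟩
  set y : ℝ → E3 := fun t => p 1 t - p 2 t with hy
  set x : ℝ → E3 := fun t => p 1 t - p 3 t with hx
  set Y : E3 := q 1 - q 2 with hY
  set X : E3 := q 1 - q 3 with hX
  have hY0 : Y ≠ 0 := by
    rintro h
    rw [h] at hcol
    exact hcol (by rw [cross3_anticomm, cross3_zero_right, neg_zero])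
  have hYpos : 0 < ‖Y‖ := norm_pos_iff.2 hY0
  have hyd : ∀ t, 0 ≤ t → HasDerivAt y (-(μ 2 * (‖y t‖ - ‖Y‖) * ‖y t‖⁻¹) • y t) t := by
    intro t ht
    convert! (h1 t ht).sub (h2 t ht) using 1
    rw [zero_sub, ← neg_smul]
    rfl
  obtain ⟨⟨e, he, hye⟩, hr⟩ := radial_tracking hμ2 (fun _ _ => le_rfl) (fun _ _ => le_rfl)
    (fun _ _ => norm_nonneg Y) tendsto_const_nhds h20 hyd
  have hrc : ∀ t, 0 ≤ t → ContinuousAt (fun s => ‖y s‖ ^ 2) t := fun t ht =>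
    ((hyd t ht).continuousAt.norm).pow 2
  obtain ⟨A, hA⟩ := exists_upper_bound_of_tendsto hrc (hr.pow 2)
  obtain ⟨B, hB⟩ := exists_upper_bound_of_tendsto
    (fun t ht => (hrc t ht).inv₀ (by have := (hye t ht).1; positivity))
    ((hr.pow 2).inv₀ (by positivity))
  have hB0 : 0 < B := lt_of_lt_of_le
    (by have := (hye 0 le_rfl).1; positivity : 0 < (‖y 0‖ ^ 2)⁻¹) (hB 0 le_rfl)
  have hrB : ∀ t, 0 ≤ t → B⁻¹ ≤ ‖y t‖ ^ 2 := fun t ht =>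
    inv_le_of_inv_le₀ (by have := (hye t ht).1; positivity) (hB t ht)
  set w : ℝ → E3 := fun t => cross3 e (x t) with hw
  have hcyx : ∀ t, 0 ≤ t → cross3 (y t) (x t) = ‖y t‖ • w t := by
    intro t ht
    conv_lhs => rw [(hye t ht).2]
    rw [cross3_smul_left]
  have hnt : ∀ t, 0 ≤ t → n123t p t = ‖w t‖⁻¹ • w t := by
    intro t ht
    have h0 := (hye t ht).1.ne'
    change ‖cross3 (p 1 t - p 3 t) (p 2 t - p 3 t)‖⁻¹ • cross3 (p 1 t - p 3 t) (p 2 t - p 3 t) = _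
    rw [cross3_sub_sub]
    change ‖cross3 (y t) (x t)‖⁻¹ • cross3 (y t) (x t) = _
    rw [hcyx t ht, norm_smul, norm_norm, smul_smul]
    congr 1
    rw [mul_inv, mul_right_comm, inv_mul_cancel₀ h0, one_mul]
  have hφ : ∀ t, 0 ≤ t → phi3Til q p t = ‖y t‖ * ‖w t‖ - ‖cross3 Y X‖ := by
    intro t ht
    unfold phi3Til n123t n123s
    simp only [cross3_sub_sub]
    change ⟪x t, cross3 (‖cross3 (y t) (x t)‖⁻¹ • cross3 (y t) (x t)) (y t)⟫ -
      ⟪X, cross3 (‖cross3 Y X‖⁻¹ • cross3 Y X) Y⟫ = _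
    rw [inner_cross3_normal, inner_cross3_normal, hcyx t ht, norm_smul, norm_norm]
  have hζ : ∀ t, 0 ≤ t → zeta3Til q p t = ‖y t‖ * ⟪e, x t⟫ - ⟪X, Y⟫ := by
    intro t ht
    change ⟪x t, y t⟫ - ⟪X, Y⟫ = _
    conv_lhs => rw [(hye t ht).2]
    rw [real_inner_smul_right, real_inner_comm]
  have hxd : ∀ t, 0 ≤ t → HasDerivAt x (-((μ 3 * zeta3Til q p t * ‖y t‖) • e +
      (ν 3 * phi3Til q p t * ‖y t‖) • cross3 (n123t p t) e)) t := by
    intro t ht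
    convert! (h1 t ht).sub (h3 t ht) using 1
    change _ = 0 - ((μ 3 * zeta3Til q p t) • y t +
      (ν 3 * phi3Til q p t) • cross3 (n123t p t) (y t))
    conv_rhs => rw [(hye t ht).2]
    rw [zero_sub, cross3_smul_right, smul_smul, smul_smul]
  have hen : ∀ t, 0 ≤ t → ⟪e, n123t p t⟫ = 0 := by
    intro t ht
    rw [hnt t ht, real_inner_smul_right, inner_cross3_self_left, mul_zero]
  have hee : ⟪e, e⟫ = 1 := by rw [real_inner_self_eq_norm_sq, he, one_pow]
  have hu : Tendsto (fun t => ⟪e, x t⟫) atTop (𝓝 (⟪X, Y⟫ / ‖Y‖)) := by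
    refine tendsto_of_linear_tracking (α := fun t => μ 3 * ‖y t‖ ^ 2)
      (β := fun t => ⟪X, Y⟫ / ‖y t‖) (a := μ 3 * B⁻¹) (A := μ 3 * A) (by positivity)
      (fun t ht => mul_le_mul_of_nonneg_left (hrB t ht) hμ3.le)
      (fun t ht => mul_le_mul_of_nonneg_left (hA t ht) hμ3.le)
      (tendsto_const_nhds.div hr hYpos.ne') fun t ht => ?_
    convert! (hasDerivAt_const t e).inner ℝ (hxd t ht) using 1
    rw [inner_zero_left, add_zero, inner_neg_right, inner_add_right, real_inner_smul_right,
      real_inner_smul_right, inner_cross3_comm e, cross3_self, inner_zero_right, hee, hζ t ht]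
    have := (hye t ht).1.ne'
    field_simp
    ring
  have hw0 : w 0 ≠ 0 := by
    intro h
    apply h30
    change cross3 (y 0) (x 0) = 0
    rw [hcyx 0 le_rfl, h, smul_zero]
  have hwd : ∀ t, 0 ≤ t → HasDerivAt w
      (-(ν 3 * ‖y t‖ ^ 2 * (‖w t‖ - ‖cross3 Y X‖ / ‖y t‖) * ‖w t‖⁻¹) • w t) t := by
    intro t ht
    convert! hasDerivAt_cross3_const e (hxd t ht) using 1
    have hneg : ∀ v : E3, -v = (-1 : ℝ) • v := fun v => by simp
    rw [hneg, cross3_smul_right, cross3_add_right, cross3_smul_right, cross3_smul_right,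
      cross3_self, smul_zero, zero_add, cross3_cross3, hee, hen t ht, one_smul, zero_smul,
      sub_zero, hnt t ht, hφ t ht, smul_smul, smul_smul]
    congr 1
    have := (hye t ht).1.ne'
    field_simp
  obtain ⟨⟨n, hn, hwn⟩, hρ⟩ := radial_tracking (α := fun t => ν 3 * ‖y t‖ ^ 2)
    (β := fun t => ‖cross3 Y X‖ / ‖y t‖) (a := ν 3 * B⁻¹) (A := ν 3 * A) (by positivity)
    (fun t ht => mul_le_mul_of_nonneg_left (hrB t ht) hν3.le)
    (fun t ht => mul_le_mul_of_nonneg_left (hA t ht) hν3.le)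
    (fun t _ => by positivity) (tendsto_const_nhds.div hr hYpos.ne') hw0 hwd
  have hen0 : ⟪e, n⟫ = 0 := by
    have h := hen 0 le_rfl
    rw [hnt 0 le_rfl, (hwn 0 le_rfl).2, norm_smul, norm_norm, hn, mul_one, smul_smul,
      inv_mul_cancel₀ (hwn 0 le_rfl).1.ne', one_smul] at h
    exact h
  obtain ⟨R, hR, hdet, hRe, hRn⟩ := exists_rotation (e := ‖Y‖⁻¹ • Y)
    (n := ‖cross3 Y X‖⁻¹ • cross3 Y X)
    (by rw [norm_smul, norm_inv, norm_norm, inv_mul_cancel₀ hYpos.ne'])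
    (by rw [norm_smul, norm_inv, norm_norm, inv_mul_cancel₀ (norm_ne_zero_iff.2 hcol)])
    (by rw [real_inner_smul_left, real_inner_smul_right, inner_cross3_self_left, mul_zero,
      mul_zero]) he hn hen0
  have hYlim : Tendsto y atTop (𝓝 (act R Y)) := by
    have h : act R Y = ‖Y‖ • e := by
      rw [← hRe, ← map_smul, smul_smul, mul_inv_cancel₀ hYpos.ne', one_smul]
    rw [h]
    refine (hr.smul_const e).congr' ?_
    filter_upwards [eventually_ge_atTop 0] with t ht using (hye t ht).2.symm
  have hXlim : Tendsto x atTop (𝓝 (act R X)) := by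
    rw [act_leading_triangle hR hdet hY0 hcol hRe hRn]
    refine ((hu.smul_const e).add (hρ.smul_const (cross3 n e))).congr' ?_
    filter_upwards [eventually_ge_atTop 0] with t ht
    conv_rhs => rw [eq_inner_smul_add_cross3 he (x t)]
    rw [← cross3_smul_left, ← (hwn t ht).2]
  refine ⟨R, hR, hdet, p 1 0 - act R (q 1), fun i hi1 hi3 => ?_⟩
  have hlim : Tendsto (fun t => p 1 t - p i t) atTop (𝓝 (act R (q 1 - q i))) := by
    interval_cases i
    · simp
    · exact hYlim
    · exact hXlim
  have hfin : rigid R (p 1 0 - act R (q 1)) (q i) = p 1 0 - act R (q 1 - q i) := by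
    rw [rigid_eq, map_sub]
    abel
  rw [hfin]
  refine (hlim.const_sub (p 1 0)).congr' ?_
  filter_upwards [eventually_ge_atTop 0] with t ht
  rw [hp1 t ht, sub_sub_cancel]

/-! ### The normals of the ordinary followers -/

lemma tendsto_act_n123 {R : Matrix (Fin 3) (Fin 3) ℝ}
    (hR : R ∈ Matrix.orthogonalGroup (Fin 3) ℝ) (hdet : R.det = 1) {d : E3} {q : ℕ → E3}
    {p : ℕ → ℝ → E3} (hcol : cross3 (q 1 - q 3) (q 2 - q 3) ≠ 0)
    (h1 : Tendsto (p 1) atTop (𝓝 (rigid R d (q 1))))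
    (h2 : Tendsto (p 2) atTop (𝓝 (rigid R d (q 2))))
    (h3 : Tendsto (p 3) atTop (𝓝 (rigid R d (q 3)))) :
    Tendsto (n123t p) atTop (𝓝 (act R (n123s q))) := by
  have h := tendsto_cross3 (h1.sub h3) (h2.sub h3)
  rw [rigid_sub, rigid_sub, cross3_act hR hdet] at h
  have hn := h.norm.inv₀ (by rwa [norm_act hR, norm_ne_zero_iff])
  rw [norm_act hR] at hn
  rw [n123s, map_smul]
  exact hn.smul h

lemma tendsto_act_nijk {R : Matrix (Fin 3) (Fin 3) ℝ}
    (hR : R ∈ Matrix.orthogonalGroup (Fin 3) ℝ) (hdet : R.det = 1) {d : E3} {q : ℕ → E3}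
    {σ1 σ2 σ3 : ℕ → ℕ} {p : ℕ → ℝ → E3} {l : ℕ}
    (hn : Tendsto (n123t p) atTop (𝓝 (act R (n123s q))))
    (h1 : Tendsto (p (σ1 l)) atTop (𝓝 (rigid R d (q (σ1 l)))))
    (h2 : Tendsto (p (σ2 l)) atTop (𝓝 (rigid R d (q (σ2 l)))))
    (h3 : Tendsto (p (σ3 l)) atTop (𝓝 (rigid R d (q (σ3 l))))) :
    Tendsto (nijk σ1 σ2 σ3 p l) atTop (𝓝 (act R (nijks σ1 σ2 σ3 q l))) := by
  unfold nijk nijks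
  split_ifs
  · exact hn
  · have h := tendsto_cross3 (h1.sub h3) (h2.sub h3)
    rwa [rigid_sub, rigid_sub, cross3_act hR hdet] at h

lemma inner_sub_nijk (σ1 σ2 σ3 : ℕ → ℕ) (p : ℕ → ℝ → E3) (l : ℕ) (t : ℝ) :
    ⟪p (σ1 l) t - p (σ2 l) t, nijk σ1 σ2 σ3 p l t⟫ = 0 := by
  unfold nijk n123t
  split_ifs with h
  · rw [h.1, h.2.1, cross3_sub_sub, real_inner_smul_right, inner_cross3_self_left, mul_zero]
  · rw [cross3_sub_sub, inner_cross3_self_left]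

lemma cross3_ne_zero_of_signedVol {a b c d : E3} (h : signedVol a b c d ≠ 0) :
    cross3 (a - c) (b - c) ≠ 0 := by
  intro h0
  apply h
  have key : signedVol a b c d = -(1 / 6) * ⟪c - d, cross3 (a - c) (b - c)⟫ := by
    simp only [signedVol, inner_E3, cross3_apply_zero, cross3_apply_one, cross3_apply_two,
      PiLp.sub_apply]
    ring
  rw [key, h0, inner_zero_right, mul_zero]

lemma nijks_ne_zero {σ1 σ2 σ3 : ℕ → ℕ} {q : ℕ → E3} {l : ℕ}
    (hcol : cross3 (q 1 - q 3) (q 2 - q 3) ≠ 0)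
    (hvol : signedVol (q (σ1 l)) (q (σ2 l)) (q (σ3 l)) (q l) ≠ 0) :
    nijks σ1 σ2 σ3 q l ≠ 0 := by
  unfold nijks n123s
  split_ifs
  · exact smul_ne_zero (inv_ne_zero (norm_ne_zero_iff.2 hcol)) hcol
  · exact cross3_ne_zero_of_signedVol hvol

/-! ### Convergence of the whole formation -/

lemma formation_tendsto {N : ℕ} {σ1 σ2 σ3 : ℕ → ℕ} {q : ℕ → E3} {μ ν lam : ℕ → ℝ}
    {p : ℕ → ℝ → E3} (hN : 4 ≤ N)
    (hσ : ∀ l : ℕ, 4 ≤ l → l ≤ N → 1 ≤ σ1 l ∧ σ1 l < σ2 l ∧ σ2 l < σ3 l ∧ σ3 l < l)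
    (hvol : ∀ l : ℕ, 4 ≤ l → l ≤ N →
      signedVol (q (σ1 l)) (q (σ2 l)) (q (σ3 l)) (q l) ≠ 0)
    (hcol : cross3 (q 1 - q 3) (q 2 - q 3) ≠ 0)
    (hμ : ∀ l : ℕ, 2 ≤ l → l ≤ N → 0 < μ l)
    (hν : ∀ l : ℕ, 3 ≤ l → l ≤ N → 0 < ν l)
    (hlam : ∀ l : ℕ, 4 ≤ l → l ≤ N → 0 < lam l)
    (hcl : ClosedLoop N σ1 σ2 σ3 q μ ν lam p) :
    ∃ R ∈ Matrix.orthogonalGroup (Fin 3) ℝ, R.det = 1 ∧ ∃ d : E3,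
      ∀ l, 1 ≤ l → l ≤ N → Tendsto (p l) atTop (𝓝 (rigid R d (q l))) := by
  obtain ⟨R, hR, hdet, d, htri⟩ := leading_triangle_tendsto hcol (hμ 2 le_rfl (by lia))
    (hμ 3 (by lia) (by lia)) (hν 3 le_rfl (by lia)) hcl
  refine ⟨R, hR, hdet, d, fun l => ?_⟩
  have hn := tendsto_act_n123 hR hdet hcol (htri 1 le_rfl (by lia)) (htri 2 (by lia) (by lia))
    (htri 3 (by lia) le_rfl)
  induction l using Nat.strong_induction_on with
  | _ l ih =>
    intro hl1 hlN
    by_cases hl : l ≤ 3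
    · exact htri l hl1 hl
    replace hl : 4 ≤ l := by lia
    obtain ⟨s1, s2, s3, s4⟩ := hσ l hl hlN
    have hi := ih (σ1 l) (by lia) (by lia) (by lia)
    have hj := ih (σ2 l) (by lia) (by lia) (by lia)
    have hk := ih (σ3 l) (by lia) (by lia) (by lia)
    have hm := tendsto_act_nijk hR hdet hn hi hj hk
    have hij := hi.sub hj
    rw [rigid_sub] at hij
    have act_ne_zero : ∀ v : E3, v ≠ 0 → act R v ≠ 0 := fun v hv => by
      rwa [← norm_ne_zero_iff, norm_act hR, norm_ne_zero_iff]
    refine follower_tendsto (hμ l (by lia) hlN) (hν l (by lia) hlN) (hlam l hl hlN) hi hij hm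
      (act_ne_zero _ fun h => ?_) (act_ne_zero _ (nijks_ne_zero hcol (hvol l hl hlN)))
      (inner_sub_nijk σ1 σ2 σ3 p l) ?_ ?_ ?_ (hcl.2.2.2.2.2 l hl hlN)
    · apply cross3_ne_zero_of_signedVol (hvol l hl hlN)
      rw [sub_eq_zero.1 h, cross3_self]
    · rw [rigid_sub, inner_act hR]
    · rw [rigid_sub, cross3_act hR hdet, inner_act hR]
    · rw [rigid_sub, inner_act hR]

/-- Global asymptotic stability of the desired formation: along the
closed loop all projection errors converge to `0` and the framework converges to the
set of configurations strongly congruent to the desired configuration `q`. -/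
theorem formation_GAS
    (N : ℕ) (hN : 4 ≤ N)
    (σ1 σ2 σ3 : ℕ → ℕ)
    (hσ : ∀ l : ℕ, 4 ≤ l → l ≤ N →
      1 ≤ σ1 l ∧ σ1 l < σ2 l ∧ σ2 l < σ3 l ∧ σ3 l < l)
    (q : ℕ → E3)
    (hvol : ∀ l : ℕ, 4 ≤ l → l ≤ N →
      signedVol (q (σ1 l)) (q (σ2 l)) (q (σ3 l)) (q l) ≠ 0)
    (hcol : cross3 (q 1 - q 3) (q 2 - q 3) ≠ 0)
    (μ ν lam : ℕ → ℝ)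
    (hμ : ∀ l : ℕ, 2 ≤ l → l ≤ N → 0 < μ l)
    (hν : ∀ l : ℕ, 3 ≤ l → l ≤ N → 0 < ν l)
    (hlam : ∀ l : ℕ, 4 ≤ l → l ≤ N → 0 < lam l)
    (p : ℕ → ℝ → E3)
    (hcl : ClosedLoop N σ1 σ2 σ3 q μ ν lam p) :
    Tendsto (zeta2Til q p) atTop (nhds 0) ∧
    Tendsto (zeta3Til q p) atTop (nhds 0) ∧
    Tendsto (phi3Til q p) atTop (nhds 0) ∧
    (∀ l : ℕ, 4 ≤ l → l ≤ N →
      Tendsto (zetaTil σ1 σ2 σ3 q p l) atTop (nhds 0) ∧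
      Tendsto (phiTil σ1 σ2 σ3 q p l) atTop (nhds 0) ∧
      Tendsto (thetaTil σ1 σ2 σ3 q p l) atTop (nhds 0)) ∧
    Tendsto (fun t : ℝ => Metric.infDist (fun i : Fin N => p (i.1 + 1) t) (SCgt N q))
      atTop (nhds 0) := by
  obtain ⟨R, hR, hdet, d, hp⟩ := formation_tendsto hN hσ hvol hcol hμ hν hlam hcl
  have hdiff : ∀ i j, 1 ≤ i → i ≤ N → 1 ≤ j → j ≤ N →
      Tendsto (fun t => p i t - p j t) atTop (𝓝 (act R (q i - q j))) := by
    intro i j hi hi' hj hj'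
    rw [← rigid_sub R d]
    exact (hp i hi hi').sub (hp j hj hj')
  have h12 := hdiff 1 2 le_rfl (by lia) (by lia) (by lia)
  have h13 := hdiff 1 3 le_rfl (by lia) (by lia) (by lia)
  have hn := tendsto_act_n123 hR hdet hcol (hp 1 le_rfl (by lia)) (hp 2 (by lia) (by lia))
    (hp 3 (by lia) (by lia))
  refine ⟨?_, ?_, ?_, fun l hl hlN => ?_, ?_⟩
  · unfold zeta2Til
    simpa only [norm_act hR, sub_self] using h12.norm.sub_const ‖q 1 - q 2‖
  · unfold zeta3Til
    simpa only [inner_act hR, sub_self] using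
      (h13.inner h12).sub_const ⟪q 1 - q 3, q 1 - q 2⟫
  · unfold phi3Til
    simpa only [cross3_act hR hdet, inner_act hR, sub_self] using
      (h13.inner (tendsto_cross3 hn h12)).sub_const
        ⟪q 1 - q 3, cross3 (n123s q) (q 1 - q 2)⟫
  · obtain ⟨s1, s2, s3, s4⟩ := hσ l hl hlN
    have hm := tendsto_act_nijk hR hdet hn (hp (σ1 l) (by lia) (by lia))
      (hp (σ2 l) (by lia) (by lia)) (hp (σ3 l) (by lia) (by lia))
    have hil := hdiff (σ1 l) l (by lia) (by lia) (by lia) hlN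
    have hij := hdiff (σ1 l) (σ2 l) (by lia) (by lia) (by lia) (by lia)
    refine ⟨?_, ?_, ?_⟩
    · unfold zetaTil
      simpa only [inner_act hR, sub_self] using
        (hil.inner hij).sub_const ⟪q (σ1 l) - q l, q (σ1 l) - q (σ2 l)⟫
    · unfold phiTil
      simpa only [cross3_act hR hdet, inner_act hR, sub_self] using
        (hil.inner (tendsto_cross3 hm hij)).sub_const
          ⟪q (σ1 l) - q l, cross3 (nijks σ1 σ2 σ3 q l) (q (σ1 l) - q (σ2 l))⟫
    · unfold thetaTil
      simpa only [inner_act hR, sub_self] using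
        (hil.inner hm).sub_const ⟪q (σ1 l) - q l, nijks σ1 σ2 σ3 q l⟫
  · set c : Fin N → E3 := fun i => rigid R d (q (i.1 + 1)) with hc
    have hmem : c ∈ SCgt N q := ⟨R, d, hR, hdet, fun _ => rfl⟩
    have hlim : Tendsto (fun t => fun i : Fin N => p (i.1 + 1) t) atTop (𝓝 c) :=
      tendsto_pi_nhds.2 fun i => hp (i.1 + 1) (by lia) i.2
    exact squeeze_zero (fun _ => Metric.infDist_nonneg)
      (fun _ => Metric.infDist_le_dist_of_mem hmem) (tendsto_iff_dist_tendsto_zero.1 hlim)
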